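/- Let k be a field, A a finite-dimensional self-injective k-algebra, X a finitely generated A-module, and let 0 → Z → P → ν_A(X) → 0 be any short exact sequence of A-modules with P projective. Then there is an isomorphism of k-vector spaces D(StHom_A(X,Y)) ≅ StHom_A(Y,Z), natural in the A-module Y (an isomorphism of contravariant functors from A-Mod to k-vector spaces). (Lemma on the Auslander–Reiten formula for self-injective algebras: D StHom_A(X,-) ≅ StHom_A(-, ν_A(X)[-1]).) -/

import Mathlib

open CategoryTheory
/-! ## Additive closure classes -/

section AddClosure

variable (A : Type) [Ring A]

/-- `X ∈ add M`: `X` is a direct summand of a finite direct sum of copies of `M`. -/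
def MemAdd (M X : ModuleCat.{0} A) : Prop :=
  ∃ (n : ℕ) (Y : ModuleCat.{0} A), Nonempty ((↥X × ↥Y) ≃ₗ[A] (Fin n → ↥M))

/-- `X ∈ Add M`: `X` is a direct summand of an arbitrary direct sum of copies of `M`. -/
def MemAddBig (M X : ModuleCat.{0} A) : Prop :=
  ∃ (I : Type) (Y : ModuleCat.{0} A), Nonempty ((↥X × ↥Y) ≃ₗ[A] (I →₀ ↥M))

/-- a morphism of `A`-modules factors through a projective module -/
def FactorsThroughProj {X Y : ModuleCat.{0} A} (f : X ⟶ Y) : Prop :=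
  ∃ (P : ModuleCat.{0} A) (_ : Module.Projective A P) (g : X ⟶ P) (h : P ⟶ Y), f = g ≫ h

/-- a morphism of `A`-modules factors through a module in `Add M` -/
def FactorsThroughAddM (M : ModuleCat.{0} A) {X Y : ModuleCat.{0} A} (f : X ⟶ Y) : Prop :=
  ∃ (Z : ModuleCat.{0} A) (_ : MemAddBig A M Z) (g : X ⟶ Z) (h : Z ⟶ Y), f = g ≫ h

/-- `X ∈ add M` for unbundled modules. -/
def MemAddPlain (M : Type) [AddCommGroup M] [Module A M]
    (X : Type) [AddCommGroup X] [Module A X] : Prop :=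
  ∃ (n : ℕ) (Y : ModuleCat.{0} A), Nonempty ((X × ↥Y) ≃ₗ[A] (Fin n → M))

end AddClosure

/-! ## The Nakayama functor `ν_A = D ∘ Hom_A(-, A)` -/

section Nakayama

variable (k A : Type) [Field k] [Ring A] [Algebra k A]

/-- Right multiplication by `a : A` on `Hom_A(X, A)`, as a `k`-linear map. -/
@[simps] def rmulHom (X : Type) [AddCommGroup X] [Module A X] (a : A) :
    (X →ₗ[A] A) →ₗ[k] (X →ₗ[A] A) where
  toFun f :=
    { toFun := fun x => f x * a
      map_add' := fun x y => by simp [add_mul]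
      map_smul' := fun c x => by simp [mul_assoc] }
  map_add' f g := by ext x; simp [add_mul]
  map_smul' c f := by ext x; simp [Algebra.smul_def, mul_assoc]

/-- The carrier of the Nakayama functor value `ν_A(X) = D(Hom_A(X,A))`,
where `D = Hom_k(-,k)`. -/
abbrev NuCarrier (X : Type) [AddCommGroup X] [Module A X] : Type :=
  (X →ₗ[A] A) →ₗ[k] k

/-- The left `A`-module structure on `ν_A(X) = D(Hom_A(X,A))`: `(a • φ) f = φ (f · a)`. -/
instance (X : Type) [AddCommGroup X] [Module A X] : Module A (NuCarrier k A X) where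
  smul a φ := φ.comp (rmulHom k A X a)
  one_smul φ := by
    refine LinearMap.ext fun f => ?_
    exact congrArg φ (by ext x; simp)
  mul_smul a b φ := by
    refine LinearMap.ext fun f => ?_
    exact congrArg φ (by ext x; simp [mul_assoc])
  smul_zero a := rfl
  smul_add a φ ψ := rfl
  add_smul a b φ := by
    refine LinearMap.ext fun f => ?_
    show φ ((rmulHom k A X (a + b)) f) = φ ((rmulHom k A X a) f) + φ ((rmulHom k A X b) f)
    rw [show (rmulHom k A X (a + b)) f = (rmulHom k A X a) f + (rmulHom k A X b) f from by
      ext x; simp [mul_add]]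
    exact map_add φ _ _
  zero_smul φ := by
    refine LinearMap.ext fun f => ?_
    show φ ((rmulHom k A X 0) f) = 0
    rw [show (rmulHom k A X 0) f = 0 from by ext x; simp]
    exact map_zero φ

/-- The Nakayama functor value `ν_A(X)` as an object of `ModuleCat A`. -/
noncomputable def NuMod (X : ModuleCat.{0} A) : ModuleCat.{0} A :=
  ModuleCat.of A (NuCarrier k A ↥X)

/-- `M` is Nakayama-stable: `add M = add (ν_A M)`. -/
noncomputable def NakayamaStable (M : ModuleCat.{0} A) : Prop :=
  ∀ X : ModuleCat.{0} A, MemAdd A M X ↔ MemAdd A (NuMod k A M) X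

end Nakayama

/-! ## Central scalars and finite-dimensionality of stable Homs -/

section Central

variable (k A : Type) [Field k] [Ring A] [Algebra k A]

/-- the `A`-linear endomorphism given by the action of the central element
`algebraMap k A c`. -/
def centralSmulLin (c : k) (X : Type) [AddCommGroup X] [Module A X] : X →ₗ[A] X where
  toFun x := algebraMap k A c • x
  map_add' x y := smul_add _ x y
  map_smul' a x := by
    simp only [RingHom.id_apply, smul_smul, Algebra.commutes]

/-- `StHom_A(X, Y) = Hom_A(X,Y)/(morphisms factoring through projectives)` is
finite-dimensional over `k`: there are finitely many morphisms `f j` such that any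
morphism agrees with a `k`-linear combination of the `f j` up to a morphism factoring
through a projective module. -/
def StHomProjFinDim (X Y : ModuleCat.{0} A) : Prop :=
  ∃ (m : ℕ) (f : Fin m → (X ⟶ Y)),
    ∀ g : X ⟶ Y, ∃ c : Fin m → k,
      FactorsThroughProj A (g - ∑ j, (ModuleCat.ofHom (centralSmulLin k A (c j) ↥X : ↥X →ₗ[A] ↥X) ≫ f j))

end Central


/-! ## Projectively stable Hom-groups as `k`-vector spaces -/

section StableP

variable (k A : Type) [Field k] [Ring A] [Algebra k A]

/-- the subgroup of `Hom_A(X,Y)` generated by morphisms factoring through projectives. -/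
def projSub (X Y : ModuleCat.{0} A) : AddSubgroup (X ⟶ Y) :=
  AddSubgroup.closure {f : X ⟶ Y | FactorsThroughProj A f}

/-- the stable Hom-group `StHom_A(X,Y)` modulo morphisms factoring through projectives. -/
abbrev StHomP (X Y : ModuleCat.{0} A) : Type :=
  (X ⟶ Y) ⧸ projSub A X Y

/-- multiplication by the central element `algebraMap k A c`, as an endomorphism in
`ModuleCat A`. -/
def centralHom (c : k) (X : ModuleCat.{0} A) : X ⟶ X :=
  ModuleCat.ofHom (centralSmulLin k A c ↥X : ↥X →ₗ[A] ↥X)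

lemma centralHom_one (X : ModuleCat.{0} A) : centralHom k A (1 : k) X = 𝟙 X := by
  refine ModuleCat.hom_ext <| LinearMap.ext fun x => ?_
  show algebraMap k A (1 : k) • x = x
  simp

lemma centralHom_mul (c d : k) (X : ModuleCat.{0} A) :
    centralHom k A (c * d) X = centralHom k A c X ≫ centralHom k A d X := by
  refine ModuleCat.hom_ext <| LinearMap.ext fun x => ?_
  show algebraMap k A (c * d) • x = algebraMap k A d • (algebraMap k A c • x)
  rw [smul_smul, ← map_mul, mul_comm d c]

lemma centralHom_add (c d : k) (X : ModuleCat.{0} A) :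
    centralHom k A (c + d) X = centralHom k A c X + centralHom k A d X := by
  refine ModuleCat.hom_ext <| LinearMap.ext fun x => ?_
  show algebraMap k A (c + d) • x = algebraMap k A c • x + algebraMap k A d • x
  rw [map_add, add_smul]

lemma centralHom_zero (X : ModuleCat.{0} A) : centralHom k A (0 : k) X = 0 := by
  refine ModuleCat.hom_ext <| LinearMap.ext fun x => ?_
  show algebraMap k A (0 : k) • x = 0
  simp

lemma centralHom_naturality (c : k) {X Y : ModuleCat.{0} A} (φ : X ⟶ Y) :
    centralHom k A c X ≫ φ = φ ≫ centralHom k A c Y := by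
  refine ModuleCat.hom_ext <| LinearMap.ext fun x => ?_
  show φ (algebraMap k A c • x) = algebraMap k A c • φ x
  exact map_smul φ.hom _ x

/-- precomposition as an additive map on Hom-groups. -/
def preCompHom {X X' : ModuleCat.{0} A} (Z : ModuleCat.{0} A) (h : X' ⟶ X) :
    (X ⟶ Z) →+ (X' ⟶ Z) :=
  AddMonoidHom.mk' (fun f => h ≫ f) (fun f g => by simp [Preadditive.comp_add])

/-- precomposition descends to the projectively stable Hom-groups. -/
def stpPreComp (Z : ModuleCat.{0} A) {X X' : ModuleCat.{0} A} (h : X' ⟶ X) :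
    StHomP A X Z →+ StHomP A X' Z :=
  QuotientAddGroup.map _ _ (preCompHom A Z h) (by
    rw [projSub, AddSubgroup.closure_le]
    rintro f ⟨P, hP, u, v, rfl⟩
    rw [SetLike.mem_coe, AddSubgroup.mem_comap]
    exact AddSubgroup.subset_closure ⟨P, hP, h ≫ u, v, by simp [preCompHom]⟩)

/-- postcomposition as an additive map on Hom-groups. -/
def postCompHom {Y Z : ModuleCat.{0} A} (X : ModuleCat.{0} A) (h : Y ⟶ Z) :
    (X ⟶ Y) →+ (X ⟶ Z) :=
  AddMonoidHom.mk' (fun f => f ≫ h) (fun f g => by simp [Preadditive.add_comp])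

/-- postcomposition descends to the projectively stable Hom-groups. -/
def stpPostComp (X : ModuleCat.{0} A) {Y Z : ModuleCat.{0} A} (h : Y ⟶ Z) :
    StHomP A X Y →+ StHomP A X Z :=
  QuotientAddGroup.map _ _ (postCompHom A X h) (by
    rw [projSub, AddSubgroup.closure_le]
    rintro f ⟨P, hP, u, v, rfl⟩
    rw [SetLike.mem_coe, AddSubgroup.mem_comap]
    exact AddSubgroup.subset_closure ⟨P, hP, u, v ≫ h, by simp [postCompHom]⟩)

noncomputable instance (X Y : ModuleCat.{0} A) : SMul k (StHomP A X Y) :=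
  ⟨fun c q => stpPreComp A Y (centralHom k A c X) q⟩

lemma stp_smul_mk (c : k) {X Y : ModuleCat.{0} A} (f : X ⟶ Y) :
    (c • (QuotientAddGroup.mk f : StHomP A X Y)) =
      QuotientAddGroup.mk (centralHom k A c X ≫ f) := rfl

/-- the `k`-vector space structure on the stable Hom-group `StHom_A(X,Y)`, induced by the
action of the central elements `algebraMap k A c`. -/
noncomputable instance (X Y : ModuleCat.{0} A) : Module k (StHomP A X Y) where
  one_smul q := QuotientAddGroup.induction_on q fun f => by
    rw [stp_smul_mk, centralHom_one, Category.id_comp]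
  mul_smul c d q := QuotientAddGroup.induction_on q fun f => by
    rw [stp_smul_mk, stp_smul_mk, stp_smul_mk, centralHom_mul, Category.assoc]
  smul_zero c := map_zero (stpPreComp A Y (centralHom k A c X))
  smul_add c q₁ q₂ := map_add (stpPreComp A Y (centralHom k A c X)) q₁ q₂
  add_smul c d q := QuotientAddGroup.induction_on q fun f => by
    rw [stp_smul_mk, stp_smul_mk, stp_smul_mk, centralHom_add, Preadditive.add_comp]
    rfl
  zero_smul q := QuotientAddGroup.induction_on q fun f => by
    rw [stp_smul_mk, centralHom_zero, Limits.zero_comp]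
    rfl

/-- postcomposition with `φ`, as a `k`-linear map of stable Hom-groups (covariant). -/
noncomputable def stpPostK (X : ModuleCat.{0} A) {Y Y' : ModuleCat.{0} A} (φ : Y ⟶ Y') :
    StHomP A X Y →ₗ[k] StHomP A X Y' where
  toFun := stpPostComp A X φ
  map_add' := map_add _
  map_smul' c q := QuotientAddGroup.induction_on q fun f => by
    show stpPostComp A X φ (c • (QuotientAddGroup.mk f : StHomP A X Y)) = _
    rw [stp_smul_mk]
    show QuotientAddGroup.mk ((centralHom k A c X ≫ f) ≫ φ) =
      c • (QuotientAddGroup.mk (f ≫ φ) : StHomP A X Y')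
    rw [stp_smul_mk, Category.assoc]

/-- precomposition with `φ`, as a `k`-linear map of stable Hom-groups (contravariant). -/
noncomputable def stpPreK (Z : ModuleCat.{0} A) {Y Y' : ModuleCat.{0} A} (φ : Y ⟶ Y') :
    StHomP A Y' Z →ₗ[k] StHomP A Y Z where
  toFun := stpPreComp A Z φ
  map_add' := map_add _
  map_smul' c q := QuotientAddGroup.induction_on q fun h => by
    show stpPreComp A Z φ (c • (QuotientAddGroup.mk h : StHomP A Y' Z)) = _
    rw [stp_smul_mk]
    show QuotientAddGroup.mk (φ ≫ (centralHom k A c Y' ≫ h)) =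
      c • (QuotientAddGroup.mk (φ ≫ h) : StHomP A Y Z)
    rw [stp_smul_mk, ← Category.assoc, ← Category.assoc, centralHom_naturality]

end StableP

section SelfInjective

/-- Over a finite-dimensional algebra, a simple module killed by the annihilator of a simple
module `S` is isomorphic to `S`. -/
theorem nonempty_linearEquiv_of_annihilator_le (k : Type*) {A : Type*} [Field k] [Ring A]
    [Algebra k A] [FiniteDimensional k A] (S T : Type*) [AddCommGroup S] [Module A S]
    [AddCommGroup T] [Module A T] [IsSimpleModule A S] [IsSimpleModule A T]
    (h : Module.annihilator A S ≤ Module.annihilator A T) : Nonempty (S ≃ₗ[A] T) := by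
  let : Module k S := Module.restrictScalars k A S
  have : IsScalarTower k A S := IsScalarTower.restrictScalars k A S
  have : Module.Finite k S := Module.Finite.trans A S
  obtain ⟨s, hs⟩ := Module.Finite.fg_top (R := k) (M := S)
  let F : A →ₗ[A] (s → S) := LinearMap.pi fun i => LinearMap.toSpanSingleton A S i
  have hF : LinearMap.ker F ≤ Module.annihilator A S := by
    intro a ha
    rw [Module.mem_annihilator]
    intro x
    have hx : x ∈ Submodule.span k (s : Set S) := hs ▸ Submodule.mem_top
    induction hx using Submodule.span_induction with
    | mem x hx => exact congrFun (LinearMap.mem_ker.mp ha) ⟨x, hx⟩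
    | zero => simp
    | add x y _ _ hx hy => simp [hx, hy]
    | smul c x _ hx => rw [smul_comm, hx, smul_zero]
  have := IsSimpleModule.nontrivial A T
  obtain ⟨t, ht⟩ := exists_ne (0 : T)
  have hle : LinearMap.ker F ≤ LinearMap.ker (LinearMap.toSpanSingleton A T t) := fun a ha => by
    simpa using Module.mem_annihilator.mp (h (hF ha)) t
  let q : (A ⧸ LinearMap.ker F) →ₗ[A] T := (LinearMap.ker F).liftQ _ hle
  let j : (A ⧸ LinearMap.ker F) →ₗ[A] (s → S) := (LinearMap.ker F).liftQ F le_rfl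
  have hj : Function.Injective j :=
    LinearMap.ker_eq_bot.mp (Submodule.ker_liftQ_eq_bot _ _ _ le_rfl)
  have : IsSemisimpleModule A (A ⧸ LinearMap.ker F) := IsSemisimpleModule.of_injective j hj
  have hq : q ≠ 0 := fun h0 => ht <| by
    have := LinearMap.congr_fun h0 (Submodule.Quotient.mk 1)
    simpa [q] using this
  obtain ⟨m, ⟨e⟩⟩ := LinearMap.linearEquiv_of_ne_zero hq
  let v : T →ₗ[A] (s → S) := j ∘ₗ m.subtype ∘ₗ e.toLinearMap
  have hv : v t ≠ 0 := fun h0 => ht <| by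
    have : Function.Injective v := hj.comp (m.injective_subtype.comp e.injective)
    exact this (h0.trans (map_zero v).symm)
  obtain ⟨i, hi⟩ := Function.ne_iff.mp hv
  have hne : LinearMap.proj i ∘ₗ v ≠ 0 := fun h0 => hi (LinearMap.congr_fun h0 t)
  exact ⟨(LinearEquiv.ofBijective _ (LinearMap.bijective_of_ne_zero hne)).symm⟩

/-- Annihilators of non-isomorphic simple modules over a finite-dimensional algebra are
comaximal. -/
theorem annihilator_eq_of_sup_ne_top (k : Type*) {A : Type*} [Field k] [Ring A]
    [Algebra k A] [FiniteDimensional k A] (S T : Type*) [AddCommGroup S] [Module A S]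
    [AddCommGroup T] [Module A T] [IsSimpleModule A S] [IsSimpleModule A T]
    (h : Module.annihilator A S ⊔ Module.annihilator A T ≠ ⊤) :
    Module.annihilator A S = Module.annihilator A T := by
  obtain ⟨M, hM, hle⟩ := Ideal.exists_le_maximal _ h
  have : IsSimpleModule A (A ⧸ M) := isSimpleModule_iff_isCoatom.mpr hM.out
  have key : ∀ I : Ideal A, I.IsTwoSided → I ≤ M → I ≤ Module.annihilator A (A ⧸ M) := by
    intro I hI hIM a ha
    rw [Module.mem_annihilator]
    intro x
    obtain ⟨b, rfl⟩ := Submodule.Quotient.mk_surjective M x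
    rw [← Submodule.Quotient.mk_smul, Submodule.Quotient.mk_eq_zero]
    exact hIM (I.mul_mem_right b ha)
  obtain ⟨e₁⟩ := nonempty_linearEquiv_of_annihilator_le k S (A ⧸ M)
    (key _ inferInstance (le_sup_left.trans hle))
  obtain ⟨e₂⟩ := nonempty_linearEquiv_of_annihilator_le k T (A ⧸ M)
    (key _ inferInstance (le_sup_right.trans hle))
  exact (e₁.trans e₂.symm).annihilator_eq

/-- The annihilators of the simple quotients of the regular module. -/
def simpleAnnihilators (A : Type*) [Ring A] : Set (Ideal A) :=
  {N | ∃ M : Ideal A, M.IsMaximal ∧ N = Module.annihilator A (A ⧸ M)}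

theorem annihilator_mem_simpleAnnihilators {A : Type*} [Ring A] (S : Type*) [AddCommGroup S]
    [Module A S] [IsSimpleModule A S] : Module.annihilator A S ∈ simpleAnnihilators A := by
  obtain ⟨M, hM, ⟨e⟩⟩ := isSimpleModule_iff_quot_maximal.mp (inferInstance : IsSimpleModule A S)
  exact ⟨M, hM, e.annihilator_eq⟩

/-- The annihilator of a simple module is prime. -/
theorem exists_mem_finset_le_annihilator {A : Type*} [Ring A] (S : Type*) [AddCommGroup S]
    [Module A S] [IsSimpleModule A S] (F : Finset (Ideal A)) (hF : ∀ N ∈ F, N.IsTwoSided)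
    (h : F.inf id ≤ Module.annihilator A S) : ∃ N ∈ F, N ≤ Module.annihilator A S := by
  classical
  by_contra! hcon
  suffices ∃ a ∈ F.inf id, a ∉ Module.annihilator A S by
    obtain ⟨a, ha, hna⟩ := this
    exact hna (h ha)
  clear h
  induction F using Finset.induction_on with
  | empty =>
    have := IsSimpleModule.nontrivial A S
    obtain ⟨s, hs⟩ := exists_ne (0 : S)
    exact ⟨1, by simp, fun h1 => hs (by simpa using Module.mem_annihilator.mp h1 s)⟩
  | insert N F _ ih =>
    obtain ⟨b, hb, hbS⟩ := ih (fun N hN => hF N (Finset.mem_insert_of_mem hN))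
      (fun N hN => hcon N (Finset.mem_insert_of_mem hN))
    obtain ⟨a, ha, haS⟩ := SetLike.not_le_iff_exists.mp (hcon N (Finset.mem_insert_self N F))
    have := hF N (Finset.mem_insert_self N F)
    simp only [Module.mem_annihilator, not_forall] at hbS haS
    obtain ⟨t, ht⟩ := hbS
    obtain ⟨s, hs⟩ := haS
    obtain ⟨c, hc⟩ := IsSimpleModule.toSpanSingleton_surjective A ht s
    refine ⟨a * (c * b), ?_, fun hmem => hs ?_⟩
    · rw [Finset.inf_insert]
      exact ⟨N.mul_mem_right _ ha, Ideal.mul_mem_left _ _ (Ideal.mul_mem_left _ _ hb)⟩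
    · rw [← hc, LinearMap.toSpanSingleton_apply, smul_smul, smul_smul]
      simpa [mul_assoc] using Module.mem_annihilator.mp hmem t

theorem finite_simpleAnnihilators (k A : Type*) [Field k] [Ring A]
    [Algebra k A] [FiniteDimensional k A] : (simpleAnnihilators A).Finite := by
  have : IsArtinianRing A := IsArtinianRing.of_finite k A
  obtain ⟨I, ⟨F, hF, rfl⟩, hmin⟩ := WellFounded.has_min (wellFounded_lt (α := Ideal A))
    {I | ∃ F : Finset (Ideal A), (F : Set (Ideal A)) ⊆ simpleAnnihilators A ∧ I = F.inf id}
    ⟨_, ∅, by simp, rfl⟩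
  refine F.finite_toSet.subset ?_
  rintro _ ⟨M, hM, rfl⟩
  classical
  have : IsSimpleModule A (A ⧸ M) := isSimpleModule_iff_isCoatom.mpr hM.out
  have hle : F.inf id ≤ Module.annihilator A (A ⧸ M) := by
    have h := hmin _ ⟨insert (Module.annihilator A (A ⧸ M)) F, by
      rw [Finset.coe_insert, Set.insert_subset_iff]
      exact ⟨⟨M, hM, rfl⟩, hF⟩, rfl⟩
    rw [Finset.inf_insert] at h
    by_contra hn
    exact h (lt_of_le_of_ne inf_le_right fun heq => hn (heq ▸ inf_le_left))
  obtain ⟨N, hN, hNle⟩ := exists_mem_finset_le_annihilator (A ⧸ M) F (fun N hN => by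
    obtain ⟨M', -, rfl⟩ := hF hN
    infer_instance) hle
  obtain ⟨M', hM', rfl⟩ := hF hN
  have : IsSimpleModule A (A ⧸ M') := isSimpleModule_iff_isCoatom.mpr hM'.out
  rw [← annihilator_eq_of_sup_ne_top k (A ⧸ M') (A ⧸ M)]
  · exact hN
  · rw [sup_eq_right.mpr hNle, Ne, Ideal.eq_top_iff_one, Module.mem_annihilator]
    intro h1
    apply hM.ne_top
    rw [Ideal.eq_top_iff_one]
    simpa [Submodule.Quotient.mk_eq_zero] using h1 (Submodule.Quotient.mk 1)

/-- A proper two-sided ideal of a left self-injective algebra has a nonzero left annihilator. -/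
theorem exists_ne_zero_forall_mul_eq_zero (k : Type*) {A : Type*} [Field k] [Ring A]
    [Algebra k A] [FiniteDimensional k A] [Module.Injective A A] (N : Ideal A) [N.IsTwoSided]
    (hN : N ≠ ⊤) : ∃ y : A, y ≠ 0 ∧ ∀ n ∈ N, y * n = 0 := by
  classical
  by_contra! hcon
  obtain ⟨s, hs⟩ := IsNoetherian.noetherian (N.restrictScalars k)
  let F : A →ₗ[A] (s → A) := LinearMap.pi fun i => LinearMap.toSpanSingleton A A i
  have hF : Function.Injective F := by
    rw [← LinearMap.ker_eq_bot, Submodule.eq_bot_iff]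
    intro y hy
    by_contra hy0
    obtain ⟨n, hn, hne⟩ := hcon y hy0
    have hn' : n ∈ Submodule.span k (s : Set A) := hs ▸ hn
    apply hne
    clear hne hn
    induction hn' using Submodule.span_induction with
    | mem x hx => exact congrFun (LinearMap.mem_ker.mp hy) ⟨x, hx⟩
    | zero => simp
    | add x z _ _ hx hz => rw [mul_add, hx, hz, add_zero]
    | smul c x _ hx => rw [mul_smul_comm, hx, smul_zero]
  obtain ⟨r, hr⟩ := Module.Injective.out F hF (LinearMap.id : A →ₗ[A] A)
  apply hN
  rw [Ideal.eq_top_iff_one, ← LinearMap.id_apply (R := A) (1 : A), ← hr 1,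
    LinearMap.pi_apply_eq_sum_univ r]
  refine Ideal.sum_mem _ fun i _ => ?_
  have : (i : A) ∈ N.restrictScalars k := hs ▸ Submodule.subset_span i.2
  simpa [F] using N.mul_mem_right _ this

/-- Every simple module over a finite-dimensional left self-injective algebra embeds into the
regular module. -/
theorem exists_simple_ideal_linearEquiv (k : Type*) {A : Type*} [Field k] [Ring A]
    [Algebra k A] [FiniteDimensional k A] [Module.Injective A A] (S : Type*) [AddCommGroup S]
    [Module A S] [IsSimpleModule A S] : ∃ I : Ideal A, Nonempty (S ≃ₗ[A] I) := by
  have : IsArtinianRing A := IsArtinianRing.of_finite k A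
  have hex : ∀ N : simpleAnnihilators A, ∃ I : Ideal A, IsSimpleModule A I ∧
      ∀ y ∈ I, ∀ n ∈ N.1, y * n = 0 := by
    rintro ⟨_, M, hM, rfl⟩
    have : IsSimpleModule A (A ⧸ M) := isSimpleModule_iff_isCoatom.mpr hM.out
    have := IsSimpleModule.nontrivial A (A ⧸ M)
    obtain ⟨y, hy, hyn⟩ := exists_ne_zero_forall_mul_eq_zero k
      (Module.annihilator A (A ⧸ M)) (by
        rw [Ne, Module.annihilator_eq_top_iff]
        exact not_subsingleton _)
    obtain hbot | ⟨I, hI, hle⟩ := eq_bot_or_exists_atom_le (Ideal.span {y})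
    · exact absurd (Ideal.span_singleton_eq_bot.mp hbot) hy
    · refine ⟨I, isSimpleModule_iff_isAtom.mpr hI, fun z hz n hn => ?_⟩
      obtain ⟨a, rfl⟩ := Ideal.mem_span_singleton'.mp (hle hz)
      rw [mul_assoc, hyn n hn, mul_zero]
  choose I hI hann using hex
  let φ : simpleAnnihilators A → simpleAnnihilators A := fun N =>
    ⟨Module.annihilator A (I N), annihilator_mem_simpleAnnihilators (I N)⟩
  have hφ : Function.Injective φ := by
    intro N N' h
    obtain ⟨e⟩ := nonempty_linearEquiv_of_annihilator_le k (I N) (I N')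
      (congrArg Subtype.val h).le
    obtain ⟨r, hr⟩ := Module.Injective.out (I N).subtype (I N).injective_subtype
      ((I N').subtype ∘ₗ e.toLinearMap)
    have := IsSimpleModule.nontrivial A (I N)
    obtain ⟨y, hy⟩ := exists_ne (0 : I N)
    have hry : ((e y : I N') : A) = (y : A) * r 1 := by
      rw [← smul_eq_mul, ← map_smul, smul_eq_mul, mul_one]
      exact (hr y).symm
    have hsup : N.1 ⊔ N'.1 ≠ ⊤ := by
      intro htop
      have hone : (1 : A) ∈ N.1 ⊔ N'.1 := htop ▸ Submodule.mem_top
      obtain ⟨a, ha, b, hb, hab⟩ := Submodule.mem_sup.mp hone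
      apply hy
      apply e.injective
      apply Subtype.ext
      have hNa : r 1 * a ∈ N.1 := Ideal.mul_mem_left _ _ ha
      rw [map_zero, ZeroMemClass.coe_zero, ← mul_one ((e y : I N') : A), ← hab, mul_add,
        hann N' _ (e y).2 b hb, hry, mul_assoc, hann N _ y.2 _ hNa, add_zero]
    obtain ⟨_, M, hM, rfl⟩ := N
    obtain ⟨_, M', hM', rfl⟩ := N'
    have : IsSimpleModule A (A ⧸ M) := isSimpleModule_iff_isCoatom.mpr hM.out
    have : IsSimpleModule A (A ⧸ M') := isSimpleModule_iff_isCoatom.mpr hM'.out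
    exact Subtype.ext (annihilator_eq_of_sup_ne_top (A := A) k (A ⧸ M) (A ⧸ M') hsup)
  have := (finite_simpleAnnihilators k A).to_subtype
  obtain ⟨N, hN⟩ := (Finite.injective_iff_surjective.mp hφ)
    ⟨Module.annihilator A S, annihilator_mem_simpleAnnihilators S⟩
  exact ⟨I N, nonempty_linearEquiv_of_annihilator_le k S (I N)
    (congrArg Subtype.val hN).ge⟩

/-- A finite-dimensional left self-injective algebra cogenerates its modules. -/
theorem exists_linearMap_self_apply_ne_zero (k : Type*) {A : Type*} [Field k] [Ring A]
    [Algebra k A] [FiniteDimensional k A] [Module.Injective A A] {Y : Type*} [AddCommGroup Y]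
    [Module A Y] {y : Y} (hy : y ≠ 0) : ∃ α : Y →ₗ[A] A, α y ≠ 0 := by
  let t := LinearMap.toSpanSingleton A Y y
  have ht : LinearMap.ker t ≠ ⊤ := fun h => hy <| by
    have h1 : (1 : A) ∈ LinearMap.ker t := h ▸ Submodule.mem_top
    simpa [t] using h1
  obtain ⟨M, hM, hle⟩ := Ideal.exists_le_maximal _ ht
  have : IsSimpleModule A (A ⧸ M) := isSimpleModule_iff_isCoatom.mpr hM.out
  obtain ⟨I, ⟨e⟩⟩ := exists_simple_ideal_linearEquiv k (A := A) (A ⧸ M)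
  let c : A →ₗ[A] A := I.subtype ∘ₗ e.toLinearMap ∘ₗ M.mkQ
  have hc : LinearMap.ker t ≤ LinearMap.ker c := fun a ha => by
    simp [c, (Submodule.Quotient.mk_eq_zero M).mpr (hle ha)]
  obtain ⟨α, hα⟩ := Module.Injective.extension_property A A _ _ ((LinearMap.ker t).liftQ t le_rfl)
    (LinearMap.ker_eq_bot.mp (Submodule.ker_liftQ_eq_bot _ _ _ le_rfl))
    ((LinearMap.ker t).liftQ c hc)
  refine ⟨α, fun h0 => hM.ne_top ?_⟩
  have h1 := LinearMap.congr_fun hα (Submodule.Quotient.mk 1)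
  simp only [LinearMap.comp_apply, Submodule.liftQ_apply, t, LinearMap.toSpanSingleton_apply,
    one_smul, h0, c] at h1
  rw [Ideal.eq_top_iff_one, ← Submodule.Quotient.mk_eq_zero]
  exact e.injective (Subtype.ext (by simpa using h1.symm))

/-- A power of a finite-dimensional algebra is a free module. -/
theorem free_pi_of_finiteDimensional (k A ι : Type*) [Field k] [Ring A] [Algebra k A]
    [FiniteDimensional k A] : Module.Free A (ι → A) := by
  let b := Module.Free.chooseBasis k (ι → k)
  let e := Module.finBasis k A
  let v : Module.Free.ChooseBasisIndex k (ι → k) → ι → A := fun j i => algebraMap k A (b j i)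
  refine Module.Free.of_basis (Module.Basis.mk (v := v) ?_ ?_)
  · rw [linearIndependent_iff]
    intro l hl
    ext j
    refine e.ext_elem fun n => ?_
    have h := linearIndependent_iff.mp b.linearIndependent
      (l.mapRange (e.coord n) (map_zero _)) ?_
    · simpa using DFunLike.congr_fun h j
    · ext i
      have hi := congrArg (e.coord n) (congrFun hl i)
      simp only [Finsupp.linearCombination_apply, Finsupp.sum, Finset.sum_apply, Pi.smul_apply,
        smul_eq_mul, v, Pi.zero_apply, map_zero, map_sum, ← Algebra.commutes,
        ← Algebra.smul_def, map_smul] at hi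
      rw [Finsupp.linearCombination_apply, Finsupp.sum_mapRange_index (by simp)]
      simpa [Finsupp.sum, mul_comm] using hi
  · intro x _
    have hmem : ∀ w : ι → k, (fun i => algebraMap k A (w i)) ∈
        Submodule.span A (Set.range v) := by
      intro w
      induction b.mem_span w using Submodule.span_induction with
      | mem w hw =>
        obtain ⟨j, rfl⟩ := hw
        exact Submodule.subset_span ⟨j, rfl⟩
      | zero =>
        convert Submodule.zero_mem (Submodule.span A (Set.range v))
        simp
      | add w w' _ _ hw hw' =>
        convert Submodule.add_mem _ hw hw'
        simp
      | smul c w _ hw =>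
        convert Submodule.smul_mem _ (algebraMap k A c) hw
        simp
    have hx : x = ∑ n, e n • fun i => algebraMap k A (e.coord n (x i)) := by
      ext i
      conv_lhs => rw [← e.sum_repr (x i)]
      simp [Algebra.smul_def, Algebra.commutes]
    rw [hx]
    exact Submodule.sum_mem _ fun n _ => Submodule.smul_mem _ _ (hmem _)

/-- Every module over a finite-dimensional left self-injective algebra embeds into a
projective module. -/
theorem exists_injective_to_projective (k : Type*) {A : Type} [Field k] [Ring A]
    [Algebra k A] [FiniteDimensional k A] [Module.Injective A A] (Y : Type) [AddCommGroup Y]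
    [Module A Y] : ∃ (I : ModuleCat.{0} A) (_ : Module.Projective A I) (i : Y →ₗ[A] I),
      Function.Injective i := by
  have := free_pi_of_finiteDimensional k A (Y →ₗ[A] A)
  refine ⟨ModuleCat.of A ((Y →ₗ[A] A) → A),
    inferInstanceAs (Module.Projective A ((Y →ₗ[A] A) → A)), LinearMap.pi id, ?_⟩
  refine (injective_iff_map_eq_zero _).mpr fun y hy => ?_
  by_contra hne
  obtain ⟨α, hα⟩ := exists_linearMap_self_apply_ne_zero (A := A) k hne
  exact hα (congrFun hy α)

/-- Only finitely many components of a map from a finite module to a free module are nonzero. -/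
theorem finite_support_lapply_comp {A X ι : Type*} [Ring A] [AddCommGroup X] [Module A X]
    [Module.Finite A X] (u : X →ₗ[A] ι →₀ A) :
    (Function.support fun i => Finsupp.lapply i ∘ₗ u).Finite := by
  classical
  obtain ⟨s, hs⟩ := Module.Finite.fg_top (R := A) (M := X)
  refine (s.biUnion fun x => (u x).support).finite_toSet.subset fun i hi => ?_
  by_contra hn
  apply hi
  refine LinearMap.ext_on hs fun x hx => ?_
  simp only [Finset.coe_biUnion, Set.mem_iUnion, not_exists] at hn
  simpa using hn x hx

/-- Projective modules over a left Noetherian left self-injective ring are injective. -/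
theorem injective_of_projective {A P : Type*} [Ring A] [IsNoetherianRing A]
    [Module.Injective A A] [AddCommGroup P] [Module A P] [Module.Projective A P] :
    Module.Injective A P := by
  classical
  obtain ⟨s, hs⟩ := Module.projective_def'.mp (inferInstance : Module.Projective A P)
  refine Module.Baer.injective fun J u => ?_
  have hsup := finite_support_lapply_comp (s ∘ₗ u)
  choose r hr using fun i => Module.Injective.extension_property A A _ _ J.subtype
    J.injective_subtype (Finsupp.lapply i ∘ₗ (s ∘ₗ u))
  let c : P →₀ A := Finsupp.onFinset hsup.toFinset
    (fun i => if i ∈ hsup.toFinset then r i 1 else 0) (by simp +contextual)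
  refine ⟨LinearMap.toSpanSingleton A P (Finsupp.linearCombination A id c), fun a ha => ?_⟩
  have h : s (u ⟨a, ha⟩) = a • c := by
    ext i
    have hi := LinearMap.congr_fun (hr i) ⟨a, ha⟩
    by_cases hm : i ∈ hsup.toFinset
    · simp only [Finsupp.smul_apply, c, Finsupp.onFinset_apply, if_pos hm]
      rw [← map_smul, smul_eq_mul, mul_one]
      exact hi.symm
    · simp only [Finsupp.smul_apply, c, Finsupp.onFinset_apply, if_neg hm, smul_zero]
      rw [Set.Finite.mem_toFinset, Function.notMem_support] at hm
      exact LinearMap.congr_fun hm ⟨a, ha⟩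
  rw [LinearMap.toSpanSingleton_apply, ← map_smul, ← h]
  exact LinearMap.congr_fun hs (u ⟨a, ha⟩)

end SelfInjective

section Duality

variable {k A : Type} [Field k] [Ring A] [Algebra k A]
variable {X Y Y' P Q Z : Type} [AddCommGroup X] [Module A X] [AddCommGroup Y] [Module A Y]
  [AddCommGroup Y'] [Module A Y'] [AddCommGroup P] [Module A P] [AddCommGroup Q] [Module A Q]
  [AddCommGroup Z] [Module A Z]

variable (k X) in
/-- Postcomposition with an `A`-linear map, as a `k`-linear map. -/
def postcompLinear [Module k Y] [IsScalarTower k A Y] [Module k Y'] [IsScalarTower k A Y']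
    (w : Y →ₗ[A] Y') : (X →ₗ[A] Y) →ₗ[k] (X →ₗ[A] Y') where
  toFun u := w ∘ₗ u
  map_add' u v := LinearMap.comp_add u v w
  map_smul' c u := LinearMap.ext fun x => w.map_smul_of_tower c (u x)

theorem postcompLinear_smulRight [Module k Y] [IsScalarTower k A Y] [Module k Y']
    [IsScalarTower k A Y'] (w : Y →ₗ[A] Y') (α : X →ₗ[A] A) (y : Y) :
    postcompLinear k X w (α.smulRight y) = α.smulRight (w y) := by
  ext x
  simp [postcompLinear]

/-- A map from a finite module to a projective module is a finite sum of maps factoring through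
the regular module. -/
theorem exists_eq_sum_smulRight [Module.Finite A X] [Module.Projective A Q] (u : X →ₗ[A] Q) :
    ∃ (F : Finset Q) (α : Q → X →ₗ[A] A), u = ∑ b ∈ F, (α b).smulRight b := by
  obtain ⟨s, hs⟩ := Module.projective_def'.mp (inferInstance : Module.Projective A Q)
  have hsup := finite_support_lapply_comp (s ∘ₗ u)
  refine ⟨hsup.toFinset, fun b => Finsupp.lapply b ∘ₗ (s ∘ₗ u), LinearMap.ext fun x => ?_⟩
  conv_lhs => rw [← LinearMap.id_apply (R := A) (u x), ← hs]
  rw [LinearMap.comp_apply, Finsupp.linearCombination_apply, LinearMap.sum_apply,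
    Finsupp.sum_of_support_subset (s := hsup.toFinset) _ ?_ _ (by simp)]
  · simp
  · intro b hb
    rw [hsup.mem_toFinset, Function.mem_support]
    intro h0
    exact Finsupp.mem_support_iff.mp hb (LinearMap.congr_fun h0 x)

/-- A functional on `Hom_A(X, Y)` vanishing on the maps that factor through the regular module
vanishes on those that factor through a projective module. -/
theorem dual_eq_zero_of_smulRight [Module.Finite A X] [Module.Projective A Q] [Module k Y]
    [IsScalarTower k A Y] {δ : (X →ₗ[A] Y) →ₗ[k] k}
    (h : ∀ (α : X →ₗ[A] A) (y : Y), δ (α.smulRight y) = 0) (u : X →ₗ[A] Q) (v : Q →ₗ[A] Y) :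
    δ (v ∘ₗ u) = 0 := by
  obtain ⟨F, α, rfl⟩ := exists_eq_sum_smulRight u
  have : v ∘ₗ ∑ b ∈ F, (α b).smulRight b = ∑ b ∈ F, (α b).smulRight (v b) := by
    ext x
    simp
  rw [this, map_sum]
  exact Finset.sum_eq_zero fun b _ => h _ _

/-- A functional on `Hom_A(X, Q)` gives a map `Q → ν_A(X)`. -/
def dualToNu [Module k Q] [IsScalarTower k A Q] (δ : (X →ₗ[A] Q) →ₗ[k] k) :
    Q →ₗ[A] NuCarrier k A X where
  toFun q :=
    { toFun := fun α => δ (α.smulRight q)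
      map_add' := fun α β => by
        rw [← map_add]
        congr 1
        ext x
        simp [add_smul]
      map_smul' := fun c α => by
        rw [RingHom.id_apply, ← map_smul]
        congr 1
        ext x
        simp }
  map_add' q r := LinearMap.ext fun α => by
    change δ _ = δ _ + δ _
    rw [← map_add]
    congr 1
    ext x
    simp
  map_smul' a q := LinearMap.ext fun α => by
    change δ (α.smulRight (a • q)) = δ ((rmulHom k A X a α).smulRight q)
    congr 1
    ext x
    simp [smul_smul]

/-- If `P` is projective, every map `P → ν_A(X)` comes from a functional on `Hom_A(X, P)`. -/
theorem exists_dualToNu_eq [Module.Finite A X] [Module.Projective A P] [Module k P]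
    [IsScalarTower k A P] (g : P →ₗ[A] NuCarrier k A X) :
    ∃ γ : (X →ₗ[A] P) →ₗ[k] k, dualToNu γ = g := by
  obtain ⟨s, hs⟩ := Module.projective_def'.mp (inferInstance : Module.Projective A P)
  have hsup : ∀ u : X →ₗ[A] P,
      (Function.support fun b => g b (Finsupp.lapply b ∘ₗ (s ∘ₗ u))).Finite := fun u =>
    (finite_support_lapply_comp (s ∘ₗ u)).subset fun b hb h0 => hb (by
      exact (congrArg (g b) h0).trans (map_zero (g b)))
  let γ : (X →ₗ[A] P) →ₗ[k] k :=
    { toFun := fun u => ∑ᶠ b : P, g b (Finsupp.lapply b ∘ₗ (s ∘ₗ u))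
      map_add' := fun u v => by
        rw [← finsum_add_distrib (hsup u) (hsup v)]
        simp only [LinearMap.comp_add, map_add]
      map_smul' := fun c u => by
        rw [RingHom.id_apply, smul_finsum' c (hsup u)]
        refine finsum_congr fun b => ?_
        rw [← map_smul]
        congr 1
        ext x
        simp }
  refine ⟨γ, LinearMap.ext fun p => LinearMap.ext fun α => ?_⟩
  have hterm : ∀ b : P, g b (Finsupp.lapply b ∘ₗ (s ∘ₗ α.smulRight p)) = g (s p b • b) α := by
    intro b
    rw [map_smul]
    change _ = g b (rmulHom k A X (s p b) α)
    congr 1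
    ext x
    simp
  change ∑ᶠ b : P, g b (Finsupp.lapply b ∘ₗ (s ∘ₗ α.smulRight p)) = g p α
  simp only [hterm]
  rw [finsum_eq_sum_of_support_subset (s := (s p).support) _ (fun b hb => by
    rw [Finset.mem_coe, Finsupp.mem_support_iff]
    intro h0
    exact hb (by simp [h0]))]
  have hp : p = ∑ b ∈ (s p).support, s p b • b := by
    conv_lhs => rw [← LinearMap.id_apply (R := A) p, ← hs]
    simp [Finsupp.linearCombination_apply, Finsupp.sum]
  conv_rhs => rw [hp, map_sum, LinearMap.sum_apply]

/-- A linear map whose range lies in the range of an injective map `f` factors through `f`. -/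
theorem exists_comp_eq_of_range_le {R M N L : Type*} [Ring R] [AddCommGroup M] [AddCommGroup N]
    [AddCommGroup L] [Module R M] [Module R N] [Module R L] {f : M →ₗ[R] N}
    (hf : Function.Injective f) {w : L →ₗ[R] N} (h : LinearMap.range w ≤ LinearMap.range f) :
    ∃ v : L →ₗ[R] M, f ∘ₗ v = w := by
  refine ⟨(LinearEquiv.ofInjective f hf).symm.toLinearMap ∘ₗ
    w.codRestrict _ fun x => h ⟨x, rfl⟩, LinearMap.ext fun x => ?_⟩
  exact congrArg Subtype.val ((LinearEquiv.ofInjective f hf).apply_symm_apply _)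

/-- A functional killing the kernel of a linear map factors through that map. -/
theorem exists_dual_comp_eq {V W : Type*} [AddCommGroup V] [Module k V] [AddCommGroup W]
    [Module k W] (p : V →ₗ[k] W) (δ : V →ₗ[k] k) (h : ∀ v, p v = 0 → δ v = 0) :
    ∃ ε : W →ₗ[k] k, ∀ v, ε (p v) = δ v := by
  have hmem : δ ∈ LinearMap.range p.dualMap := by
    rw [LinearMap.range_dualMap_eq_dualAnnihilator_ker, Submodule.mem_dualAnnihilator]
    exact fun v hv => h v hv
  obtain ⟨ε, rfl⟩ := hmem
  exact ⟨ε, fun _ => rfl⟩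

variable [Module k P] [IsScalarTower k A P] {f : Z →ₗ[A] P} {γ : (X →ₗ[A] P) →ₗ[k] k}

/-- If `γ ∘ f_*` vanishes on all maps `X → Y → Z` through `h`, then `h` factors through a
projective module. -/
theorem exists_comp_eq_of_forall_dual_eq_zero [FiniteDimensional k A] [Module.Injective A A]
    [Module.Projective A P] (hf : Function.Injective f)
    (hγ : Function.Surjective (dualToNu γ))
    (hex : LinearMap.range f = LinearMap.ker (dualToNu γ)) (h : Y →ₗ[A] Z)
    (hh : ∀ u : X →ₗ[A] Y, γ (f ∘ₗ h ∘ₗ u) = 0) :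
    ∃ (I : ModuleCat.{0} A) (_ : Module.Projective A I) (i : Y →ₗ[A] I) (v : I →ₗ[A] Z),
      h = v ∘ₗ i := by
  have : IsNoetherianRing A := IsNoetherianRing.of_finite k A
  have : Module.Injective A P := injective_of_projective
  obtain ⟨I, hI, i, hi⟩ := exists_injective_to_projective k (A := A) Y
  obtain ⟨J, hJ, j, hj⟩ := exists_injective_to_projective k (A := A) (I ⧸ LinearMap.range i)
  let _ : Module k I := Module.restrictScalars k A I
  have : IsScalarTower k A I := IsScalarTower.restrictScalars k A I
  let _ : Module k J := Module.restrictScalars k A J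
  have : IsScalarTower k A J := IsScalarTower.restrictScalars k A J
  obtain ⟨w, hw⟩ := Module.Injective.extension_property A P _ _ i hi (f ∘ₗ h)
  let q : I →ₗ[A] J := j ∘ₗ (LinearMap.range i).mkQ
  have hqi : ∀ y, q (i y) = 0 := fun y => by
    have : (LinearMap.range i).mkQ (i y) = 0 := (Submodule.Quotient.mk_eq_zero _).mpr ⟨y, rfl⟩
    simp only [q, LinearMap.comp_apply, this, map_zero]
  obtain ⟨δ, hδ⟩ := exists_dual_comp_eq (postcompLinear k X q) (γ ∘ₗ postcompLinear k X w) (by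
    intro u hu
    obtain ⟨u', rfl⟩ := exists_comp_eq_of_range_le hi (w := u) (by
      rintro _ ⟨x, rfl⟩
      rw [← Submodule.Quotient.mk_eq_zero]
      exact hj ((LinearMap.congr_fun hu x).trans (map_zero j).symm))
    change γ (w ∘ₗ i ∘ₗ u') = 0
    rw [← LinearMap.comp_assoc, hw]
    exact hh u')
  obtain ⟨m, hm⟩ := Module.projective_lifting_property (dualToNu γ) (dualToNu δ) hγ
  have hrange : LinearMap.range (w - m ∘ₗ q) ≤ LinearMap.range f := by
    rw [hex]
    rintro _ ⟨t, rfl⟩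
    rw [LinearMap.mem_ker, LinearMap.sub_apply, map_sub, sub_eq_zero, LinearMap.comp_apply,
      ← LinearMap.comp_apply (dualToNu γ) m, hm]
    refine LinearMap.ext fun α => ?_
    have h1 := hδ (α.smulRight t)
    rw [LinearMap.comp_apply, postcompLinear_smulRight, postcompLinear_smulRight] at h1
    exact h1.symm
  obtain ⟨v, hv⟩ := exists_comp_eq_of_range_le hf hrange
  refine ⟨I, hI, i, v, LinearMap.ext fun y => hf ?_⟩
  have h1 := LinearMap.congr_fun hv (i y)
  have h2 := LinearMap.congr_fun hw y
  simp only [LinearMap.comp_apply, LinearMap.sub_apply, hqi, map_zero, sub_zero] at h1 h2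
  rw [LinearMap.comp_apply, h1, h2]

/-- A functional on `Hom_A(X, Y)` vanishing on the maps that factor through the regular module
is induced by a map `Y → Z`. -/
theorem exists_forall_dual_comp_eq [FiniteDimensional k A] [Module.Injective A A]
    [Module.Finite A X] [Module k Y] [IsScalarTower k A Y] (hf : Function.Injective f)
    (hγ : Function.Surjective (dualToNu γ))
    (hex : LinearMap.range f = LinearMap.ker (dualToNu γ)) (ψ : (X →ₗ[A] Y) →ₗ[k] k)
    (hψ : dualToNu ψ = 0) :
    ∃ h : Y →ₗ[A] Z, ∀ u : X →ₗ[A] Y, γ (f ∘ₗ h ∘ₗ u) = ψ u := by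
  obtain ⟨I, hI, i, hi⟩ := exists_injective_to_projective k (A := A) Y
  let _ : Module k I := Module.restrictScalars k A I
  have : IsScalarTower k A I := IsScalarTower.restrictScalars k A I
  obtain ⟨δ, hδ⟩ := exists_dual_comp_eq (postcompLinear k X i) ψ (fun u hu => by
    have : u = 0 := LinearMap.ext fun x => hi ((LinearMap.congr_fun hu x).trans (map_zero i).symm)
    rw [this, map_zero])
  obtain ⟨w, hw⟩ := Module.projective_lifting_property (dualToNu γ) (dualToNu δ) hγ
  have hdiff : ∀ u : X →ₗ[A] I, γ (w ∘ₗ u) = δ u := by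
    intro u
    have := dual_eq_zero_of_smulRight (δ := γ ∘ₗ postcompLinear k X w - δ) (fun α t => by
      rw [LinearMap.sub_apply, LinearMap.comp_apply, postcompLinear_smulRight, sub_eq_zero]
      exact LinearMap.congr_fun (LinearMap.congr_fun hw t) α) u LinearMap.id
    exact sub_eq_zero.mp this
  obtain ⟨h, hh⟩ := exists_comp_eq_of_range_le hf (w := w ∘ₗ i) (by
    rw [hex]
    rintro _ ⟨y, rfl⟩
    rw [LinearMap.mem_ker, LinearMap.comp_apply, ← LinearMap.comp_apply (dualToNu γ) w, hw]
    refine LinearMap.ext fun α => ?_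
    change δ (α.smulRight (i y)) = 0
    rw [← postcompLinear_smulRight (k := k), hδ]
    exact LinearMap.congr_fun (LinearMap.congr_fun hψ y) α)
  refine ⟨h, fun u => ?_⟩
  rw [← LinearMap.comp_assoc, hh, LinearMap.comp_assoc, hdiff]
  exact hδ u

end Duality

section StablePairing

variable {k A : Type} [Field k] [Ring A] [Algebra k A]

theorem centralHom_comp_ofHom {X Y : ModuleCat.{0} A} [Module k Y] [IsScalarTower k A Y]
    (c : k) (u : X →ₗ[A] Y) :
    centralHom k A c X ≫ ModuleCat.ofHom u = ModuleCat.ofHom (c • u) := by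
  refine ModuleCat.hom_ext (LinearMap.ext fun x => ?_)
  change u (algebraMap k A c • x) = c • u x
  rw [map_smul, algebraMap_smul]

/-- A functional on `Hom_A(X, Z)` vanishing on the maps that factor through the regular module
descends to the stable Hom-space. -/
noncomputable def stableFunctional {X Z : ModuleCat.{0} A} [Module.Finite A X] [Module k Z]
    [IsScalarTower k A Z] (δ : (X →ₗ[A] Z) →ₗ[k] k)
    (hδ : ∀ (α : X →ₗ[A] A) (z : Z), δ (α.smulRight z) = 0) : StHomP A X Z →ₗ[k] k where
  toFun := QuotientAddGroup.lift (projSub A X Z)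
    (AddMonoidHom.mk' (fun u => δ u.hom) fun u v => map_add δ u.hom v.hom) (by
      rw [projSub, AddSubgroup.closure_le]
      rintro _ ⟨Q, hQ, u, v, rfl⟩
      exact dual_eq_zero_of_smulRight hδ u.hom v.hom)
  map_add' := map_add _
  map_smul' c q := QuotientAddGroup.induction_on q fun u => by
    rw [stp_smul_mk, ← ModuleCat.ofHom_hom u, centralHom_comp_ofHom]
    exact map_smul δ c u.hom

/-- Composition with stable maps `Y → Z`, followed by a functional on `StHom_A(X, Z)`. -/
noncomputable def stablePairing {X Z : ModuleCat.{0} A} (θ : StHomP A X Z →ₗ[k] k)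
    (Y : ModuleCat.{0} A) : StHomP A Y Z →ₗ[k] Module.Dual k (StHomP A X Y) where
  toFun := QuotientAddGroup.lift (projSub A Y Z)
    (AddMonoidHom.mk' (fun h => θ ∘ₗ stpPostK k A X h) fun h h' =>
      LinearMap.ext fun q => QuotientAddGroup.induction_on q fun u => by
        change θ (QuotientAddGroup.mk (u ≫ (h + h'))) =
          θ (QuotientAddGroup.mk (u ≫ h)) + θ (QuotientAddGroup.mk (u ≫ h'))
        rw [Preadditive.comp_add, QuotientAddGroup.mk_add, map_add]) (by
      rw [projSub, AddSubgroup.closure_le]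
      rintro _ ⟨Q, hQ, v, w, rfl⟩
      refine LinearMap.ext fun q => QuotientAddGroup.induction_on q fun u => ?_
      change θ (QuotientAddGroup.mk (u ≫ v ≫ w)) = 0
      rw [(QuotientAddGroup.eq_zero_iff _).mpr, map_zero]
      exact AddSubgroup.subset_closure ⟨Q, hQ, u ≫ v, w, (Category.assoc _ _ _).symm⟩)
  map_add' := map_add _
  map_smul' c q := QuotientAddGroup.induction_on q fun h =>
    LinearMap.ext fun r => QuotientAddGroup.induction_on r fun u => by
      change θ (QuotientAddGroup.mk (u ≫ centralHom k A c Y ≫ h)) =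
        c • θ (QuotientAddGroup.mk (u ≫ h))
      rw [← map_smul, stp_smul_mk, ← Category.assoc, ← centralHom_naturality, Category.assoc]

theorem stablePairing_naturality {X Y Y' Z : ModuleCat.{0} A} (θ : StHomP A X Z →ₗ[k] k)
    (φ : Y ⟶ Y') (q : StHomP A Y' Z) :
    (stpPostK k A X φ).dualMap (stablePairing θ Y' q) =
      stablePairing θ Y (stpPreK k A Z φ q) :=
  QuotientAddGroup.induction_on q fun h =>
    LinearMap.ext fun r => QuotientAddGroup.induction_on r fun u => by
      change θ (QuotientAddGroup.mk ((u ≫ φ) ≫ h)) = θ (QuotientAddGroup.mk (u ≫ φ ≫ h))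
      rw [Category.assoc]

end StablePairing

/-- **Auslander–Reiten formula for self-injective algebras**. Let `A` be a
finite-dimensional self-injective `k`-algebra, `X` a finitely generated `A`-module, and
`0 → Z → P → ν_A(X) → 0` a short exact sequence with `P` projective (so that
`Z = ν_A(X)[-1]` in the stable category). Then there is an isomorphism of `k`-vector
spaces `D(StHom_A(X,Y)) ≅ StHom_A(Y,Z)` natural in `Y`. -/
theorem auslander_reiten_duality_for_self_injective
    (k A : Type) [Field k] [Ring A] [Algebra k A] [FiniteDimensional k A]
    [Module.Injective A A]
    (X : ModuleCat.{0} A) [Module.Finite A ↥X]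
    (Z P : ModuleCat.{0} A) (f : Z ⟶ P) (g : P ⟶ NuMod k A X)
    (hP : Module.Projective A ↥P) (hf : Function.Injective f)
    (hg : Function.Surjective g) (hex : LinearMap.range f.hom = LinearMap.ker g.hom) :
    ∃ e : (Y : ModuleCat.{0} A) → (Module.Dual k (StHomP A X Y) ≃ₗ[k] StHomP A Y Z),
      ∀ (Y Y' : ModuleCat.{0} A) (φ : Y ⟶ Y') (ψ : Module.Dual k (StHomP A X Y')),
        e Y ((stpPostK k A X φ).dualMap ψ) = stpPreK k A Z φ (e Y' ψ) := by
  have := hP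
  let _ : Module k P := Module.restrictScalars k A P
  have : IsScalarTower k A P := IsScalarTower.restrictScalars k A P
  let _ : Module k Z := Module.restrictScalars k A Z
  have : IsScalarTower k A Z := IsScalarTower.restrictScalars k A Z
  obtain ⟨γ, hγ⟩ := exists_dualToNu_eq (k := k) (X := X) g.hom
  replace hg : Function.Surjective (dualToNu γ) := hγ ▸ hg
  replace hex : LinearMap.range f.hom = LinearMap.ker (dualToNu γ) := hγ ▸ hex
  let θ := stableFunctional (γ ∘ₗ postcompLinear k X f.hom) fun α z => by
    have hz : dualToNu γ (f.hom z) = 0 := LinearMap.mem_ker.mp (hex ▸ ⟨z, rfl⟩)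
    rw [LinearMap.comp_apply, postcompLinear_smulRight]
    exact LinearMap.congr_fun hz α
  have hbij : ∀ Y, Function.Bijective (stablePairing θ Y) := by
    intro Y
    let _ : Module k Y := Module.restrictScalars k A Y
    have : IsScalarTower k A Y := IsScalarTower.restrictScalars k A Y
    constructor
    · refine (injective_iff_map_eq_zero _).mpr fun q => QuotientAddGroup.induction_on q ?_
      intro h hh
      obtain ⟨I, hI, i, v, hiv⟩ := exists_comp_eq_of_forall_dual_eq_zero hf hg hex h.hom
        fun u => LinearMap.congr_fun hh (QuotientAddGroup.mk (ModuleCat.ofHom u))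
      rw [QuotientAddGroup.eq_zero_iff]
      exact AddSubgroup.subset_closure
        ⟨I, hI, ModuleCat.ofHom i, ModuleCat.ofHom v, ModuleCat.hom_ext hiv⟩
    · intro ψ
      let ψ' : (X →ₗ[A] Y) →ₗ[k] k :=
        { toFun := fun u => ψ (QuotientAddGroup.mk (ModuleCat.ofHom u))
          map_add' := fun u v => map_add ψ (QuotientAddGroup.mk (ModuleCat.ofHom u))
            (QuotientAddGroup.mk (ModuleCat.ofHom v))
          map_smul' := fun c u => by
            rw [RingHom.id_apply, ← map_smul, stp_smul_mk, centralHom_comp_ofHom] }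
      obtain ⟨h, hh⟩ := exists_forall_dual_comp_eq hf hg hex ψ' (by
        refine LinearMap.ext fun y => LinearMap.ext fun α => ?_
        change ψ (QuotientAddGroup.mk (ModuleCat.ofHom (α.smulRight y))) = 0
        rw [(QuotientAddGroup.eq_zero_iff _).mpr, map_zero]
        exact AddSubgroup.subset_closure ⟨ModuleCat.of A A,
          inferInstanceAs (Module.Projective A A), ModuleCat.ofHom α,
          ModuleCat.ofHom (LinearMap.toSpanSingleton A Y y), rfl⟩)
      refine ⟨QuotientAddGroup.mk (ModuleCat.ofHom h), LinearMap.ext fun q =>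
        QuotientAddGroup.induction_on q fun u => hh u.hom⟩
  refine ⟨fun Y => (LinearEquiv.ofBijective _ (hbij Y)).symm, fun Y Y' φ ψ => ?_⟩
  obtain ⟨q, rfl⟩ := (hbij Y').2 ψ
  rw [LinearEquiv.symm_apply_eq]
  have hq : (LinearEquiv.ofBijective _ (hbij Y')).symm (stablePairing θ Y' q) = q :=
    (LinearEquiv.ofBijective _ (hbij Y')).symm_apply_apply q
  rw [hq]
  exact stablePairing_naturality θ φ q
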